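/- arXiv:1602.08818 — 2 statements merged into one kernel-verified Lean document; each statement's English description precedes it below -/
import Mathlib

section
/- Schmidt decomposition: for every matrix c : Fin m × Fin n → ℂ with Σ_{k,μ} |c (k,μ)|² = 1, there exist r ∈ ℕ, an orthonormal family u : Fin r → EuclideanSpace ℂ (Fin m), an orthonormal family w : Fin r → EuclideanSpace ℂ (Fin n), and reals p : Fin r → ℝ with p j > 0 for all j and Σ_j p j = 1, such that c (k, μ) = Σ_j √(p j) · (u j) k · (w j) μ for all k, μ. -/
open scoped ComplexConjugate

open Matrix in
/-- Some orthonormal basis diagonalizes `C * Cᴴ`, so the coefficient vectors of the columns of `C`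
in that basis are pairwise orthogonal. -/
theorem exists_orthonormalBasis_pairwise_inner_coeff_eq_zero {m n : Type*} [Fintype m] [Fintype n]
    (C : Matrix m n ℂ) :
    ∃ e : OrthonormalBasis m ℂ (EuclideanSpace ℂ m), Pairwise fun i j =>
      inner ℂ (WithLp.toLp 2 fun μ => inner ℂ (e i) (WithLp.toLp 2 (C.col μ)) : EuclideanSpace ℂ n)
        (WithLp.toLp 2 fun μ => inner ℂ (e j) (WithLp.toLp 2 (C.col μ))) = 0 := by
  classical
  have hA : (C * Cᴴ).IsHermitian := isHermitian_mul_conjTranspose_self C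
  refine ⟨hA.eigenvectorBasis, fun i j hij => ?_⟩
  set e := hA.eigenvectorBasis
  have hv (i : m) : (fun μ => inner ℂ (e i) (WithLp.toLp 2 (C.col μ))) =
      star (Cᴴ *ᵥ (e i).ofLp) := by
    ext μ
    rw [EuclideanSpace.inner_eq_star_dotProduct, star_mulVec, conjTranspose_conjTranspose,
      dotProduct_comm]
    rfl
  have hji : star (e j).ofLp ⬝ᵥ (e i).ofLp = 0 := by
    rw [dotProduct_comm, ← EuclideanSpace.inner_eq_star_dotProduct]
    exact e.orthonormal.2 hij.symm
  rw [hv, hv, EuclideanSpace.inner_toLp_toLp, star_star, star_mulVec, conjTranspose_conjTranspose,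
    ← dotProduct_mulVec, mulVec_mulVec, hA.mulVec_eigenvectorBasis, dotProduct_smul, hji, smul_zero]

/-- Rescaling a nonzero pairwise orthogonal family to unit length makes it orthonormal. -/
theorem orthonormal_norm_inv_smul {𝕜 E ι : Type*} [RCLike 𝕜] [NormedAddCommGroup E]
    [InnerProductSpace 𝕜 E] {v : ι → E} (hne : ∀ i, v i ≠ 0)
    (hv : Pairwise fun i j => inner 𝕜 (v i) (v j) = 0) :
    Orthonormal 𝕜 fun i => ((‖v i‖⁻¹ : ℝ) : 𝕜) • v i := by
  refine ⟨fun i => ?_, fun i j hij => ?_⟩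
  · simp [norm_smul, hne i]
  · simp [inner_smul_left, inner_smul_right, hv hij]

/-- Schmidt decomposition of a normalized bipartite coefficient
matrix. -/
theorem schmidt_decomposition
    (m n : ℕ) (c : Fin m × Fin n → ℂ)
    (hnorm : ∑ k : Fin m, ∑ μ : Fin n, ‖c (k, μ)‖ ^ 2 = 1) :
    ∃ (r : ℕ) (u : Fin r → EuclideanSpace ℂ (Fin m))
      (w : Fin r → EuclideanSpace ℂ (Fin n)) (p : Fin r → ℝ),
      Orthonormal ℂ u ∧ Orthonormal ℂ w ∧ (∀ j, 0 < p j) ∧ (∑ j, p j = 1) ∧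
      ∀ (k : Fin m) (μ : Fin n),
        c (k, μ) = ∑ j, (Real.sqrt (p j) : ℂ) * u j k * w j μ := by
  classical
  obtain ⟨e, he⟩ := exists_orthonormalBasis_pairwise_inner_coeff_eq_zero
    (Matrix.of fun k μ => c (k, μ))
  set col : Fin n → EuclideanSpace ℂ (Fin m) := fun μ => WithLp.toLp 2 fun k => c (k, μ) with hcol
  set v : Fin m → EuclideanSpace ℂ (Fin n) := fun i =>
    WithLp.toLp 2 fun μ => inner ℂ (e i) (col μ) with hvdef
  have hv : Pairwise fun i j => inner ℂ (v i) (v j) = 0 := he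
  let f := (Fintype.equivFin {i // v i ≠ 0}).symm
  have hf : Function.Injective fun j => (f j : Fin m) :=
    Subtype.val_injective.comp f.injective
  have hne (j) : v (f j) ≠ 0 := (f j).2
  have hsum {M : Type} [AddCommMonoid M] (g : Fin m → M) (hg : ∀ i, v i = 0 → g i = 0) :
      ∑ j, g (f j) = ∑ i, g i := by
    refine Fintype.sum_of_injective _ hf _ g (fun i hi => hg i ?_) fun _ => rfl
    by_contra h
    exact hi ⟨f.symm ⟨i, h⟩, by simp⟩
  refine ⟨_, fun j => e (f j), fun j => ((‖v (f j)‖⁻¹ : ℝ) : ℂ) • v (f j),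
    fun j => ‖v (f j)‖ ^ 2, e.orthonormal.comp _ hf,
    orthonormal_norm_inv_smul hne (hv.comp_of_injective hf),
    fun j => pow_pos (norm_pos_iff.2 (hne j)) 2, ?_, fun k μ => ?_⟩
  · rw [hsum (fun i => ‖v i‖ ^ 2) fun i hi => by simp [hi]]
    simp_rw [EuclideanSpace.norm_sq_eq]
    rw [Finset.sum_comm, ← hnorm, Finset.sum_comm (s := Finset.univ (α := Fin m))]
    refine Finset.sum_congr rfl fun μ _ => ?_
    exact (e.sum_sq_norm_inner_right (col μ)).trans (EuclideanSpace.norm_sq_eq _)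
  · have hterm (j) : (Real.sqrt (‖v (f j)‖ ^ 2) : ℂ) * e (f j) k *
        (((‖v (f j)‖⁻¹ : ℝ) : ℂ) • v (f j)) μ = v (f j) μ * e (f j) k := by
      have : (‖v (f j)‖ : ℂ) ≠ 0 := by exact_mod_cast norm_ne_zero_iff.2 (hne j)
      rw [Real.sqrt_sq (norm_nonneg _), PiLp.smul_apply, smul_eq_mul, Complex.ofReal_inv]
      field_simp
    rw [Finset.sum_congr rfl fun j _ => hterm j,
      hsum (fun i => v i μ * e i k) fun i hi => by simp [hi]]
    have h := congrArg (fun x : EuclideanSpace ℂ (Fin m) => x k) (e.sum_repr' (col μ))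
    simpa [hcol, hvdef] using h.symm
end

section
/- Consistent apparatus probability: let ψ(x,y) = Σ_{k=0}^{n-1} √(p k) · α k x · φ k y with p k ≥ 0, where each α k : X → ℂ and φ k : Y → ℂ is measurable and L²-normalized (∫_X |α k|² = 1 and ∫_Y |φ k|² = 1), the support of α k is contained in D k ⊆ X, the support of φ k is contained in E k ⊆ Y, and the product sets Ω k = D k × E k are pairwise disjoint and measurable. Then for every k, ∫_{Ω k} |ψ(x,y)|² d(x,y) = p k. -/
open MeasureTheory

/-- Consistent apparatus probability: if
`ψ(x,y) = Σ_k √(p k) α k x · φ k y` with normalized factors whose supports lie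
in pairwise disjoint product cells `Ω k = D k × E k`, then
`∫_{Ω k} |ψ|² = p k` for every `k`. -/
theorem consistent_apparatus_probability
    {X Y : Type*} [MeasureSpace X] [MeasureSpace Y]
    [SigmaFinite (volume : Measure X)] [SigmaFinite (volume : Measure Y)]
    (n : ℕ) (p : Fin n → ℝ) (hp : ∀ k, 0 ≤ p k)
    (α : Fin n → X → ℂ) (φ : Fin n → Y → ℂ)
    (hα_meas : ∀ k, Measurable (α k)) (hφ_meas : ∀ k, Measurable (φ k))
    (hα_norm : ∀ k, ∫ x, ‖α k x‖ ^ 2 = 1)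
    (hφ_norm : ∀ k, ∫ y, ‖φ k y‖ ^ 2 = 1)
    (D : Fin n → Set X) (E : Fin n → Set Y)
    (hD_meas : ∀ k, MeasurableSet (D k)) (hE_meas : ∀ k, MeasurableSet (E k))
    (hα_supp : ∀ k, Function.support (α k) ⊆ D k)
    (hφ_supp : ∀ k, Function.support (φ k) ⊆ E k)
    (hdisj : Pairwise (Function.onFun Disjoint fun k => D k ×ˢ E k))
    (ψ : X × Y → ℂ)
    (hψ : ∀ x y, ψ (x, y) = ∑ k, (Real.sqrt (p k) : ℂ) * α k x * φ k y) :
    ∀ k : Fin n,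
      ∫ z in D k ×ˢ E k, ‖ψ z‖ ^ 2
          ∂((volume : Measure X).prod (volume : Measure Y)) = p k := by
  intro k
  have hcell : ∀ z ∈ D k ×ˢ E k,
      ‖ψ z‖ ^ 2 = p k * (‖α k z.1‖ ^ 2 * ‖φ k z.2‖ ^ 2) := by
    rintro ⟨x, y⟩ hz
    rw [hψ, Finset.sum_eq_single k]
    · rw [norm_mul, norm_mul, Complex.norm_real, Real.norm_eq_abs, mul_pow, mul_pow, sq_abs,
        Real.sq_sqrt (hp k), mul_assoc]
    · intro j _ hj
      by_contra h
      have hx : α j x ≠ 0 := fun h0 => h (by simp [h0])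
      have hy : φ j y ≠ 0 := fun h0 => h (by simp [h0])
      have hmem : (x, y) ∈ D j ×ˢ E j := ⟨hα_supp j hx, hφ_supp j hy⟩
      exact Set.disjoint_left.mp (hdisj hj) hmem hz
    · simp
  have hα_set : ∫ x in D k, ‖α k x‖ ^ 2 = 1 := by
    rw [setIntegral_eq_integral_of_forall_compl_eq_zero, hα_norm]
    intro x hx
    simp [Function.notMem_support.mp fun h => hx (hα_supp k h)]
  have hφ_set : ∫ y in E k, ‖φ k y‖ ^ 2 = 1 := by
    rw [setIntegral_eq_integral_of_forall_compl_eq_zero, hφ_norm]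
    intro y hy
    simp [Function.notMem_support.mp fun h => hy (hφ_supp k h)]
  rw [setIntegral_congr_fun ((hD_meas k).prod (hE_meas k)) hcell, integral_const_mul,
    setIntegral_prod_mul (fun x => ‖α k x‖ ^ 2) (fun y => ‖φ k y‖ ^ 2), hα_set, hφ_set,
    mul_one, mul_one]
end
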